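/- arXiv:2403.09473 — 7 statements merged into one kernel-verified Lean document; each statement's English description precedes it below -/
import Mathlib

section
/- Let f : ℕ → ℝ take values in [-1,1] and be eventually constant, i.e., there exist f* ∈ [-1,1] and k* ∈ ℕ with f(k) = f* for all k ≥ k*. Let θ : ℕ → ℝ satisfy θ(k+1) = θ(k) + (1 - θ(k)²)(f(k) - θ(k)) for all k, and suppose θ(k) ∈ (-1,1) for all k. Then θ(k) converges to f* as k → ∞. -/
theorem coda_aux (c : ℝ) (hc : -1 ≤ c) (u : ℕ → ℝ)
    (hrec : ∀ k, u (k + 1) = u k + (1 - (u k) ^ 2) * (c - u k))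
    (hu : ∀ k, u k ∈ Set.Ioo (-1 : ℝ) 1) (h0 : c ≤ u 0) :
    Filter.Tendsto u Filter.atTop (nhds c) := by
  have hge : ∀ k, c ≤ u k := by
    intro k
    induction k with
    | zero => exact h0
    | succ k ih =>
      have := mul_nonneg (sq_nonneg (u k)) (sub_nonneg.2 ih)
      rw [hrec]
      nlinarith
  have hanti : Antitone u := by
    apply antitone_nat_of_succ_le
    intro k
    have h1 : 0 ≤ 1 - (u k) ^ 2 := by nlinarith [(hu k).1, (hu k).2]
    have := mul_nonneg h1 (sub_nonneg.2 (hge k))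
    rw [hrec]
    nlinarith
  have hb : BddBelow (Set.range u) := ⟨c, by rintro _ ⟨k, rfl⟩; exact hge k⟩
  obtain ⟨L, hL⟩ : ∃ L, Filter.Tendsto u Filter.atTop (nhds L) :=
    ⟨_, tendsto_atTop_ciInf hanti hb⟩
  have hcL : c ≤ L := ge_of_tendsto' hL hge
  have hL1 : L < 1 := lt_of_le_of_lt (hanti.le_of_tendsto hL 0) (hu 0).2
  have h1 := (Filter.tendsto_add_atTop_iff_nat 1).2 hL
  have h2 : Filter.Tendsto (fun k => u (k + 1)) Filter.atTop
      (nhds (L + (1 - L ^ 2) * (c - L))) := by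
    simp only [hrec]
    exact hL.add (((hL.pow 2).const_sub 1).mul (hL.const_sub c))
  have h3 := tendsto_nhds_unique h1 h2
  have h4 : (1 - L) * ((1 + L) * (c - L)) = 0 := by linarith
  have : L = c := by
    rcases mul_eq_zero.1 h4 with h | h
    · linarith
    · rcases mul_eq_zero.1 h with h | h <;> linarith
  rwa [this] at hL

/-- Convergence of the CODA opinion update under an eventually constant
influence sequence: if `f : ℕ → ℝ` takes values in `[-1,1]` and equals `f*`
from some time `k*` on, and `θ` follows the recurrence
`θ(k+1) = θ(k) + (1 - θ(k)²)(f(k) - θ(k))` with `θ(k) ∈ (-1,1)` for all `k`,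
then `θ(k) → f*`. -/
theorem coda_update_tendsto_of_eventually_const
    (f : ℕ → ℝ) (hf : ∀ k, f k ∈ Set.Icc (-1 : ℝ) 1)
    (fstar : ℝ) (hfstar : fstar ∈ Set.Icc (-1 : ℝ) 1)
    (kstar : ℕ) (hconst : ∀ k ≥ kstar, f k = fstar)
    (θ : ℕ → ℝ)
    (hrec : ∀ k, θ (k + 1) = θ k + (1 - (θ k) ^ 2) * (f k - θ k))
    (hθ : ∀ k, θ k ∈ Set.Ioo (-1 : ℝ) 1) :
    Filter.Tendsto θ Filter.atTop (nhds fstar) := by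
  rw [← Filter.tendsto_add_atTop_iff_nat kstar]
  have hr : ∀ k, θ (k + 1 + kstar) = θ (k + kstar)
      + (1 - (θ (k + kstar)) ^ 2) * (fstar - θ (k + kstar)) := by
    intro k
    rw [← hconst (k + kstar) (by omega), ← hrec]
    congr 1
    omega
  rcases le_total fstar (θ (0 + kstar)) with h | h
  · exact coda_aux fstar hfstar.1 (fun k => θ (k + kstar)) hr (fun k => hθ _) h
  · have := coda_aux (-fstar) (by linarith [hfstar.2]) (fun k => -θ (k + kstar))
      (fun k => by simp only [hr]; ring)
      (fun k => ⟨by linarith [(hθ (k + kstar)).2], by linarith [(hθ (k + kstar)).1]⟩)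
      (neg_le_neg h)
    simpa using this.neg
end

section
/- Let n ∈ ℕ with n ≥ 1, let n⁺, n⁻ ∈ ℕ with n⁺ + n⁻ = n, let q_p ∈ {-1, 1}, let β ∈ [0, 1/(1+n)), and set f = (1-β)(n⁺ - n⁻)/n + β q_p. Then: (1) if n⁺ > n⁻ then f > 0, and consequently for any θ ∈ [0,1) the update θ' = θ + (1 - θ²)(f - θ) satisfies θ' > 0; (2) if n⁺ < n⁻ then f < 0, and for any θ ∈ (-1,0] the update satisfies θ' < 0. -/
/-- When `β < 1/(1+n)`, the influence value
`f = (1-β)(n⁺ - n⁻)/n + β q_p` has the sign of the local action majority: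
if `n⁺ > n⁻` then `f > 0` and the CODA update of any `θ ∈ [0,1)` stays
positive; if `n⁺ < n⁻` then `f < 0` and the update of any `θ ∈ (-1,0]`
stays negative. -/
theorem coda_majority_sign_of_small_beta
    (n nplus nminus : ℕ) (hn : 1 ≤ n) (hsum : nplus + nminus = n)
    (qp : ℝ) (hqp : qp = -1 ∨ qp = 1)
    (β : ℝ) (hβ0 : 0 ≤ β) (hβ1 : β < 1 / (1 + (n : ℝ)))
    (f : ℝ) (hf : f = (1 - β) * ((nplus : ℝ) - (nminus : ℝ)) / (n : ℝ) + β * qp) :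
    (nminus < nplus → 0 < f ∧
      ∀ θ : ℝ, 0 ≤ θ → θ < 1 → 0 < θ + (1 - θ ^ 2) * (f - θ)) ∧
    (nplus < nminus → f < 0 ∧
      ∀ θ : ℝ, -1 < θ → θ ≤ 0 → θ + (1 - θ ^ 2) * (f - θ) < 0) := by
  have hn' : (1 : ℝ) ≤ n := by exact_mod_cast hn
  have hb : β * (1 + (n : ℝ)) < 1 := by
    rwa [lt_div_iff₀ (by linarith)] at hβ1
  have hfn : f * n = (1 - β) * ((nplus : ℝ) - (nminus : ℝ)) + β * qp * n := by
    rw [hf]; field_simp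
  have hbn : 0 ≤ β * n := by positivity
  have hb1 : 0 ≤ 1 - β := by nlinarith
  constructor
  · intro h
    have h1 : (nminus : ℝ) + 1 ≤ nplus := by exact_mod_cast h
    have hm := mul_le_mul_of_nonneg_left (show (1 : ℝ) ≤ (nplus : ℝ) - nminus by linarith) hb1
    have hpos : 0 < f * n := by
      rw [hfn]
      rcases hqp with rfl | rfl <;> linarith
    have hf0 : 0 < f := pos_of_mul_pos_left hpos (by linarith)
    refine ⟨hf0, fun θ h0 h2 => ?_⟩
    have h3 : 0 < (1 - θ ^ 2) * f := mul_pos (by nlinarith) hf0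
    have h4 : 0 ≤ θ ^ 3 := by positivity
    linarith
  · intro h
    have h1 : (nplus : ℝ) + 1 ≤ nminus := by exact_mod_cast h
    have hm := mul_le_mul_of_nonneg_left (show (1 : ℝ) ≤ (nminus : ℝ) - nplus by linarith) hb1
    have hpos : 0 < (-f) * n := by
      rw [neg_mul, hfn]
      rcases hqp with rfl | rfl <;> linarith
    have hf0 : 0 < -f := pos_of_mul_pos_left hpos (by linarith)
    refine ⟨by linarith, fun θ h0 h2 => ?_⟩
    have h3 : 0 < (1 - θ ^ 2) * (-f) := mul_pos (by nlinarith) hf0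
    have h4 : 0 ≤ (-θ) ^ 3 := pow_nonneg (by linarith) 3
    linarith
end

section
/- Consider the CODA model with external signal on a finite directed graph with nonempty neighborhoods and parameter β ∈ [0,1). Let A be a subset of the agents and ε ∈ {-1,1} such that: (a) q_i(0) = ε for all i ∈ A; (b) every i ∈ A satisfies |N_i ∩ A| ≥ |N_i \ A| - (β/(1-β))·|N_i| (A is a weakly robust polarized cluster); and (c) the external signal satisfies q_p(k) = ε for all k ∈ ℕ. Then q_i(k) = ε for all i ∈ A and all k ∈ ℕ. -/
open Finset

/-- Preservation of actions in a weakly robust polarized cluster.  In the CODA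
model with external signal on a finite directed graph with nonempty
neighborhoods `Nb i` and parameter `β ∈ [0,1)`, if `A` is a set of agents all
having the same initial action `ε ∈ {-1,1}`, every `i ∈ A` satisfies
`|N_i ∩ A| ≥ |N_i \ A| - (β/(1-β))·|N_i|`, and the external signal satisfies
`q_p(k) = ε` for all `k`, then every agent of `A` keeps the action `ε`
forever. -/
theorem weakly_robust_cluster_preserves_action
    {V : Type*} [Fintype V] [DecidableEq V]
    (Nb : V → Finset V) (hNb : ∀ i, (Nb i).Nonempty)
    (β : ℝ) (hβ0 : 0 ≤ β) (hβ1 : β < 1)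
    (qp : ℕ → ℝ) (θ : V → ℕ → ℝ) (q : V → ℕ → ℝ)
    (hθmem : ∀ i k, θ i k ∈ Set.Icc (-1 : ℝ) 1)
    (hqval : ∀ i k, q i k = 1 ∨ q i k = -1)
    (hqpos : ∀ i k, 0 < θ i k → q i k = 1)
    (hqneg : ∀ i k, θ i k < 0 → q i k = -1)
    (hqtie : ∀ i k, θ i (k + 1) = 0 → q i (k + 1) = q i k)
    (hdyn : ∀ i k, θ i (k + 1) = θ i k + (1 - (θ i k) ^ 2) *
      (β * (qp k - θ i k) +
        (1 - β) * ((Nb i).card : ℝ)⁻¹ * ∑ j ∈ Nb i, (q j k - θ i k)))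
    (A : Finset V) (ε : ℝ) (hε : ε = 1 ∨ ε = -1)
    (ha : ∀ i ∈ A, q i 0 = ε)
    (hb : ∀ i ∈ A, (((Nb i ∩ A).card : ℝ)) ≥
      ((Nb i \ A).card : ℝ) - (β / (1 - β)) * ((Nb i).card : ℝ))
    (hc : ∀ k, qp k = ε) :
    ∀ i ∈ A, ∀ k, q i k = ε := by
  have hεε : ε * ε = 1 := by rcases hε with h | h <;> rw [h] <;> norm_num
  suffices H : ∀ k, ∀ i ∈ A, q i k = ε from fun i hi k => H k i hi
  intro k
  induction k with
  | zero => exact ha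
  | succ k ih =>
    intro i hi
    have hn : (0 : ℝ) < ((Nb i).card : ℝ) := by exact_mod_cast (hNb i).card_pos
    have hx0 : 0 ≤ ε * θ i k := by
      have h1 := ih i hi
      rcases hε with h | h
      · by_contra hc'
        have := hqneg i k (by rw [h] at hc'; linarith)
        linarith
      · by_contra hc'
        have := hqpos i k (by rw [h] at hc'; linarith)
        linarith
    have hsq : (θ i k) ^ 2 ≤ 1 := by
      have := hθmem i k
      nlinarith [this.1, this.2]
    have hsum : ((Nb i ∩ A).card : ℝ) - ((Nb i \ A).card : ℝ) ≤ ε * ∑ j ∈ Nb i, q j k := by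
      rw [← Finset.sum_inter_add_sum_sdiff (Nb i) A, mul_add]
      have e1 : ε * ∑ j ∈ Nb i ∩ A, q j k = ((Nb i ∩ A).card : ℝ) := by
        rw [Finset.sum_congr rfl (fun j hj => ih j (Finset.mem_inter.1 hj).2)]
        rw [Finset.sum_const, nsmul_eq_mul]
        linear_combination ((Nb i ∩ A).card : ℝ) * hεε
      have e2 : -((Nb i \ A).card : ℝ) ≤ ε * ∑ j ∈ Nb i \ A, q j k := by
        rw [Finset.mul_sum]
        have := Finset.card_nsmul_le_sum (Nb i \ A) (fun j => ε * q j k) (-1) (by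
          intro j _
          rcases hε with h | h <;> rcases hqval j k with h' | h' <;> rw [h, h'] <;> norm_num)
        rw [nsmul_eq_mul] at this
        linarith
      linarith
    have hm : 0 ≤ β + (1 - β) * ((Nb i).card : ℝ)⁻¹ * (ε * ∑ j ∈ Nb i, q j k) := by
      have h1 : -(β / (1 - β)) * ((Nb i).card : ℝ) ≤ ε * ∑ j ∈ Nb i, q j k := by
        have := hb i hi
        linarith
      have hp : 0 < 1 - β := by linarith
      have h2 := mul_le_mul_of_nonneg_left h1
        (le_of_lt (mul_pos hp (inv_pos.2 hn)))
      have h3 : (1 - β) * ((Nb i).card : ℝ)⁻¹ * (-(β / (1 - β)) * ((Nb i).card : ℝ)) = -β := by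
        field_simp
      linarith
    have hs : ∑ j ∈ Nb i, (q j k - θ i k) = ∑ j ∈ Nb i, q j k - ((Nb i).card : ℝ) * θ i k := by
      rw [Finset.sum_sub_distrib, Finset.sum_const, nsmul_eq_mul]
    have key : ε * θ i (k + 1) = (ε * θ i k) * (θ i k) ^ 2 + (1 - (θ i k) ^ 2) *
        (β + (1 - β) * ((Nb i).card : ℝ)⁻¹ * (ε * ∑ j ∈ Nb i, q j k)) := by
      have hni : ((Nb i).card : ℝ)⁻¹ * ((Nb i).card : ℝ) = 1 := inv_mul_cancel₀ hn.ne'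
      rw [hdyn, hs, hc]
      linear_combination (1 - (θ i k) ^ 2) * β * hεε
        - (1 - (θ i k) ^ 2) * (1 - β) * ε * θ i k * hni
    have hnn : 0 ≤ ε * θ i (k + 1) := by
      rw [key]
      exact add_nonneg (mul_nonneg hx0 (sq_nonneg _)) (mul_nonneg (by linarith) hm)
    rcases lt_trichotomy (θ i (k + 1)) 0 with h | h | h
    · rw [hqneg i _ h]
      rcases hε with h' | h'
      · rw [h'] at hnn; linarith
      · exact h'.symm
    · rw [hqtie i k h]; exact ih i hi
    · rw [hqpos i _ h]
      rcases hε with h' | h'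
      · exact h'.symm
      · rw [h'] at hnn; linarith
end

section
/- Consider the CODA model with external signal on a finite directed graph with nonempty neighborhoods and parameter β ∈ [0,1). Let A be a subset of the agents and ε ∈ {-1,1} such that: (a) q_i(0) = ε for all i ∈ A; and (b) every i ∈ A satisfies |N_i ∩ A| ≥ |N_i \ A| + (β/(1-β))·|N_i| (A is a strongly robust polarized cluster). Then, for every sequence of external signals q_p(k) ∈ {-1,1}, one has q_i(k) = ε for all i ∈ A and all k ∈ ℕ. -/
open Finset

/-- Preservation of actions in a strongly robust polarized cluster.  In the
CODA model with external signal on a finite directed graph with nonempty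
neighborhoods `Nb i` and parameter `β ∈ [0,1)`, if `A` is a set of agents all
having the same initial action `ε ∈ {-1,1}` and every `i ∈ A` satisfies
`|N_i ∩ A| ≥ |N_i \ A| + (β/(1-β))·|N_i|`, then, whatever the external signal
sequence `q_p(k) ∈ {-1,1}` is, every agent of `A` keeps the action `ε`
forever. -/
theorem strongly_robust_cluster_preserves_action
    {V : Type*} [Fintype V] [DecidableEq V]
    (Nb : V → Finset V) (hNb : ∀ i, (Nb i).Nonempty)
    (β : ℝ) (hβ0 : 0 ≤ β) (hβ1 : β < 1)
    (qp : ℕ → ℝ) (hqp : ∀ k, qp k = 1 ∨ qp k = -1)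
    (θ : V → ℕ → ℝ) (q : V → ℕ → ℝ)
    (hθmem : ∀ i k, θ i k ∈ Set.Icc (-1 : ℝ) 1)
    (hqval : ∀ i k, q i k = 1 ∨ q i k = -1)
    (hqpos : ∀ i k, 0 < θ i k → q i k = 1)
    (hqneg : ∀ i k, θ i k < 0 → q i k = -1)
    (hqtie : ∀ i k, θ i (k + 1) = 0 → q i (k + 1) = q i k)
    (hdyn : ∀ i k, θ i (k + 1) = θ i k + (1 - (θ i k) ^ 2) *
      (β * (qp k - θ i k) +
        (1 - β) * ((Nb i).card : ℝ)⁻¹ * ∑ j ∈ Nb i, (q j k - θ i k)))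
    (A : Finset V) (ε : ℝ) (hε : ε = 1 ∨ ε = -1)
    (ha : ∀ i ∈ A, q i 0 = ε)
    (hb : ∀ i ∈ A, (((Nb i ∩ A).card : ℝ)) ≥
      ((Nb i \ A).card : ℝ) + (β / (1 - β)) * ((Nb i).card : ℝ)) :
    ∀ i ∈ A, ∀ k, q i k = ε := by
  have hεε : ε * ε = 1 := by rcases hε with h | h <;> rw [h] <;> norm_num
  have key : ∀ k, ∀ i ∈ A, q i k = ε := by
    intro k
    induction k with
    | zero => exact ha
    | succ k ih =>
      intro i hi
      have hn : (0 : ℝ) < ((Nb i).card : ℝ) := by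
        exact_mod_cast Finset.card_pos.mpr (hNb i)
      have h1β : 0 < 1 - β := by linarith
      -- lower bound on the neighbours' sum
      have hS : ((Nb i ∩ A).card : ℝ) - ((Nb i \ A).card : ℝ) ≤ ε * ∑ j ∈ Nb i, q j k := by
        rw [← Finset.sum_inter_add_sum_sdiff (Nb i) A (fun j => q j k), mul_add]
        have e1 : ∑ j ∈ Nb i ∩ A, q j k = ((Nb i ∩ A).card : ℝ) * ε := by
          rw [Finset.sum_congr rfl (fun j hj => ih j (Finset.mem_inter.mp hj).2)]
          simp
        have e2 : -((Nb i \ A).card : ℝ) ≤ ε * ∑ j ∈ Nb i \ A, q j k := by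
          rw [Finset.mul_sum]
          have := Finset.card_nsmul_le_sum (Nb i \ A) (fun j => ε * q j k) (-1) (by
            intro j _
            rcases hε with h | h <;> rcases hqval j k with h' | h' <;> rw [h, h'] <;> norm_num)
          simpa using this
        rw [e1]
        have : ε * (((Nb i ∩ A).card : ℝ) * ε) = ((Nb i ∩ A).card : ℝ) := by
          linear_combination ((Nb i ∩ A).card : ℝ) * hεε
        linarith
      have hS2 : β / (1 - β) * ((Nb i).card : ℝ) ≤ ε * ∑ j ∈ Nb i, q j k := by
        have := hb i hi
        linarith
      have hm : β ≤ (1 - β) * ((Nb i).card : ℝ)⁻¹ * (ε * ∑ j ∈ Nb i, q j k) := by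
        calc β = (1 - β) * ((Nb i).card : ℝ)⁻¹ * (β / (1 - β) * ((Nb i).card : ℝ)) := by
              field_simp
          _ ≤ _ := mul_le_mul_of_nonneg_left hS2 (by positivity)
      have hp : -β ≤ β * (ε * qp k) := by
        rcases hε with h | h <;> rcases hqp k with h' | h' <;> rw [h, h'] <;> linarith
      have ht : 0 ≤ ε * θ i k := by
        have hq := ih i hi
        rcases hε with h | h
        · by_contra hc
          have := hqneg i k (by rw [h] at hc; linarith)
          rw [hq, h] at this; norm_num at this
        · by_contra hc
          have := hqpos i k (by rw [h] at hc; linarith)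
          rw [hq, h] at this; norm_num at this
      have hsq : 0 ≤ 1 - (θ i k) ^ 2 := by
        obtain ⟨h1, h2⟩ := hθmem i k
        nlinarith
      have hd : ε * θ i (k + 1) = (ε * θ i k) * (θ i k) ^ 2 + (1 - (θ i k) ^ 2) *
          (β * (ε * qp k) + (1 - β) * ((Nb i).card : ℝ)⁻¹ * (ε * ∑ j ∈ Nb i, q j k)) := by
        rw [hdyn i k, Finset.sum_sub_distrib, Finset.sum_const, nsmul_eq_mul]
        field_simp
        ring
      have ht' : 0 ≤ ε * θ i (k + 1) := by
        rw [hd]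
        exact add_nonneg (mul_nonneg ht (sq_nonneg _)) (mul_nonneg hsq (by linarith))
      rcases lt_trichotomy (θ i (k + 1)) 0 with h0 | h0 | h0
      · rw [hqneg i _ h0]
        rcases hε with h | h
        · rw [h] at ht'; linarith
        · exact h.symm
      · rw [hqtie i k h0]; exact ih i hi
      · rw [hqpos i _ h0]
        rcases hε with h | h
        · exact h.symm
        · rw [h] at ht'; linarith
  exact fun i hi k => key k i hi
end

section
/- Let β ∈ (1/2, 1] and let θ : ℕ → ℝ satisfy θ(k+1) = θ(k) + (1 - θ(k)²)(1 - 2β - θ(k)) for all k, with θ(0) ∈ [0, 1). Then there exists n ∈ ℕ with θ(n) < 0. Consequently, in the fully synchronized regime with β > 1/2, the action pair (q, q_p) = (1, -1) is not an equilibrium of the action dynamics: the common action q cannot remain equal to 1 while q_p remains equal to -1. -/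
/-- In the fully synchronized regime with `β ∈ (1/2, 1]`, the common opinion
dynamics `θ(k+1) = θ(k) + (1 - θ(k)²)(1 - 2β - θ(k))` starting from
`θ(0) ∈ [0,1)` eventually becomes negative; hence the synchronized action pair
`(q, q_p) = (1, -1)` is not an equilibrium of the action dynamics. -/
theorem coda_sync_one_minusone_not_equilibrium
    (β : ℝ) (hβ0 : 1 / 2 < β) (hβ1 : β ≤ 1)
    (θ : ℕ → ℝ)
    (hrec : ∀ k, θ (k + 1) = θ k + (1 - (θ k) ^ 2) * (1 - 2 * β - θ k))
    (h0 : 0 ≤ θ 0) (h1 : θ 0 < 1) :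
    ∃ n : ℕ, θ n < 0 := by
  by_contra! hn
  have hc : 0 < (1 - (θ 0) ^ 2) * (2 * β - 1) := by
    apply mul_pos
    · nlinarith
    · linarith
  have key : ∀ k : ℕ, θ k ≤ θ 0 - k * ((1 - (θ 0) ^ 2) * (2 * β - 1)) := by
    intro k
    induction k with
    | zero => simp
    | succ k ih =>
      have hk : 0 ≤ θ k := hn k
      have hle : θ k ≤ θ 0 := by
        have : 0 ≤ (k : ℝ) * ((1 - (θ 0) ^ 2) * (2 * β - 1)) := by positivity
        linarith
      have hsq : (θ k) ^ 2 ≤ (θ 0) ^ 2 := by gcongr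
      have h2 : (1 - (θ 0) ^ 2) * (2 * β - 1) ≤ (1 - (θ k) ^ 2) * (2 * β - 1 + θ k) := by
        apply mul_le_mul
        · linarith
        · linarith
        · linarith
        · nlinarith
      rw [hrec k]
      push_cast
      linarith
  obtain ⟨n, hN⟩ := exists_nat_gt (θ 0 / ((1 - (θ 0) ^ 2) * (2 * β - 1)))
  rw [div_lt_iff₀ hc] at hN
  linarith [key n, hn n]
end

section
/- Let γ ∈ (0,1), N ∈ ℕ, e_max ∈ ℝ, and p̄ ∈ ℝ with N e_max/(1-γ) ≤ p̄. Let θ : ℕ → ℝ and p : ℕ → ℝ satisfy, for all k ≥ k₀, θ(k+1) = θ(k) + (1 - θ(k)²)(1 - θ(k)) and p(k+1) = γ p(k) + N e_max, with θ(k₀) ∈ [0,1] and p(k₀) < p̄. Then for all k ≥ k₀ one has θ(k) ∈ [0,1] and p(k) < p̄. Consequently the synchronized action pair (q, q_p) = (1, 1) is an equilibrium of the action dynamics when N e_max/(1-γ) ≤ p̄. -/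
/-- Sufficiency: when `N e_max/(1-γ) ≤ p̄`, the synchronized action pair
`(q, q_p) = (1, 1)` is an equilibrium of the action dynamics: if from time
`k₀` on the common opinion follows `θ(k+1) = θ(k) + (1-θ(k)²)(1-θ(k))` and the
pollution follows `p(k+1) = γ p(k) + N e_max`, with `θ(k₀) ∈ [0,1]` and
`p(k₀) < p̄`, then `θ(k) ∈ [0,1]` and `p(k) < p̄` for all `k ≥ k₀`. -/
theorem coda_sync_one_one_equilibrium_of_threshold
    (γ : ℝ) (hγ : γ ∈ Set.Ioo (0 : ℝ) 1)
    (N : ℕ) (emax pbar : ℝ)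
    (hbar : (N : ℝ) * emax / (1 - γ) ≤ pbar)
    (θ p : ℕ → ℝ) (k₀ : ℕ)
    (hθrec : ∀ k ≥ k₀, θ (k + 1) = θ k + (1 - (θ k) ^ 2) * (1 - θ k))
    (hprec : ∀ k ≥ k₀, p (k + 1) = γ * p k + (N : ℝ) * emax)
    (hθ₀ : θ k₀ ∈ Set.Icc (0 : ℝ) 1) (hp₀ : p k₀ < pbar) :
    ∀ k ≥ k₀, θ k ∈ Set.Icc (0 : ℝ) 1 ∧ p k < pbar := by
  obtain ⟨h0, h1⟩ := hγ
  rw [div_le_iff₀ (by linarith)] at hbar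
  intro k hk
  induction k, hk using Nat.le_induction with
  | base => exact ⟨hθ₀, hp₀⟩
  | succ k hk ih =>
    obtain ⟨⟨ha, hb⟩, hp⟩ := ih
    have e1 : 0 ≤ (1 - θ k) * (θ k) ^ 2 := mul_nonneg (by linarith) (sq_nonneg _)
    have e2 : 0 ≤ (1 - (θ k) ^ 2) * (1 - θ k) :=
      mul_nonneg (by nlinarith) (by linarith)
    have e3 : γ * p k < γ * pbar := mul_lt_mul_of_pos_left hp h0
    rw [hθrec k hk, hprec k hk]
    refine ⟨⟨by linarith, by linarith⟩, by linarith⟩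
end

section
/- Let γ ∈ (0,1), N ∈ ℕ, e_min ∈ ℝ, and p̄ ∈ ℝ with N e_min/(1-γ) ≥ p̄. Let θ : ℕ → ℝ and p : ℕ → ℝ satisfy, for all k ≥ k₀, θ(k+1) = θ(k) + (1 - θ(k)²)(-1 - θ(k)) and p(k+1) = γ p(k) + N e_min, with θ(k₀) ∈ [-1,0] and p(k₀) > p̄. Then for all k ≥ k₀ one has θ(k) ∈ [-1,0] and p(k) > p̄. Consequently the synchronized action pair (q, q_p) = (-1, -1) is an equilibrium of the action dynamics when N e_min/(1-γ) ≥ p̄. -/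
/-- Sufficiency: when `N e_min/(1-γ) ≥ p̄`, the synchronized action pair
`(q, q_p) = (-1, -1)` is an equilibrium of the action dynamics: if from time
`k₀` on the common opinion follows `θ(k+1) = θ(k) + (1-θ(k)²)(-1-θ(k))` and
the pollution follows `p(k+1) = γ p(k) + N e_min`, with `θ(k₀) ∈ [-1,0]` and
`p(k₀) > p̄`, then `θ(k) ∈ [-1,0]` and `p(k) > p̄` for all `k ≥ k₀`. -/
theorem coda_sync_minusone_minusone_equilibrium_of_threshold
    (γ : ℝ) (hγ : γ ∈ Set.Ioo (0 : ℝ) 1)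
    (N : ℕ) (emin pbar : ℝ)
    (hbar : (N : ℝ) * emin / (1 - γ) ≥ pbar)
    (θ p : ℕ → ℝ) (k₀ : ℕ)
    (hθrec : ∀ k ≥ k₀, θ (k + 1) = θ k + (1 - (θ k) ^ 2) * (-1 - θ k))
    (hprec : ∀ k ≥ k₀, p (k + 1) = γ * p k + (N : ℝ) * emin)
    (hθ₀ : θ k₀ ∈ Set.Icc (-1 : ℝ) 0) (hp₀ : p k₀ > pbar) :
    ∀ k ≥ k₀, θ k ∈ Set.Icc (-1 : ℝ) 0 ∧ p k > pbar := by
  obtain ⟨hg0, hg1⟩ := hγ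
  have hb : pbar * (1 - γ) ≤ (N : ℝ) * emin := (le_div_iff₀ (by linarith)).1 hbar
  intro k hk
  induction k, hk using Nat.le_induction with
  | base => exact ⟨hθ₀, hp₀⟩
  | succ k hk ih =>
    obtain ⟨⟨h1, h2⟩, h3⟩ := ih
    have a1 : 0 ≤ (1 + θ k) * (θ k) ^ 2 := mul_nonneg (by linarith) (sq_nonneg _)
    have a2 : 0 ≤ (1 - (θ k) ^ 2) * (1 + θ k) :=
      mul_nonneg (by nlinarith) (by linarith)
    have a3 : γ * pbar < γ * p k := mul_lt_mul_of_pos_left h3 hg0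
    rw [hθrec k hk, hprec k hk]
    refine ⟨⟨?_, ?_⟩, ?_⟩
    · linarith
    · linarith
    · linarith
end
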